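/- arXiv:1811.06343 — 8 statements merged into one kernel-verified Lean document; each statement's English description precedes it below -/
import Mathlib

section
/- Let E be a real Banach space, U ⊆ E a nonempty open convex set, and let γ, b, β be real numbers with γ > 1, b > 0, β > 0. Set ε = (γ+1)(b+β). Let f : E → ℝ be Fréchet differentiable at every point of U, and let c : E → ℝ satisfy: (i) c(x) > 0 for all x ∈ U; (ii) ‖df_x‖ ≤ c(x) for all x ∈ U, where ‖df_x‖ is the operator norm of the Fréchet derivative of f at x (taken within U); (iii) c(x) ≤ exp(β·‖x′−x‖)·c(x′) for all x, x′ ∈ U (c is a β-smooth upper bound on the derivative sensitivity of f). Let μ be the probability measure on ℝ with density proportional to z ↦ 1/(1+|z|^γ). Then for all x, x′ ∈ U and every measurable set S ⊆ ℝ, the pushforward measures satisfy μ(z : f(x) + (c(x)/b)·z ∈ S) ≤ exp(ε·‖x′−x‖) · μ(z : f(x′) + (c(x′)/b)·z ∈ S); that is, the mechanism g(x) = f(x) + (c(x)/b)·η with η ~ μ is ε-differentially private with respect to the norm metric. -/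
open MeasureTheory Real

lemma aux_mono (γ : ℝ) (hγ : 1 < γ) {u v : ℝ} (hu : 0 ≤ u) (huv : u ≤ v) :
    1 + v ^ γ ≤ Real.exp (γ * (v - u)) * (1 + u ^ γ) := by
  have hanti : AntitoneOn (fun u : ℝ => (1 + u ^ γ) * Real.exp (-(γ * u))) (Set.Ici 0) := by
    have hder : ∀ u : ℝ, 0 < u → HasDerivAt (fun u : ℝ => (1 + u ^ γ) * Real.exp (-(γ * u)))
        ((γ * u ^ (γ - 1)) * Real.exp (-(γ * u)) +
          (1 + u ^ γ) * (Real.exp (-(γ * u)) * (-(γ * 1)))) u := by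
      intro u hu
      have h1 : HasDerivAt (fun u : ℝ => 1 + u ^ γ) (γ * u ^ (γ - 1)) u :=
        (Real.hasDerivAt_rpow_const (Or.inl hu.ne')).const_add 1
      have h2 : HasDerivAt (fun u : ℝ => Real.exp (-(γ * u)))
          (Real.exp (-(γ * u)) * (-(γ * 1))) u :=
        (((hasDerivAt_id u).const_mul γ).neg).exp
      exact h1.mul h2
    apply antitoneOn_of_deriv_nonpos (convex_Ici 0)
    · apply Continuous.continuousOn
      have : Continuous (fun u : ℝ => u ^ γ) := Real.continuous_rpow_const (by linarith)
      fun_prop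
    · intro u hu
      rw [interior_Ici] at hu
      exact (hder u hu).differentiableAt.differentiableWithinAt
    · intro u hu
      rw [interior_Ici] at hu
      have hu : 0 < u := hu
      rw [(hder u hu).deriv]
      have key : u ^ (γ - 1) ≤ 1 + u ^ γ := by
        rcases le_total u 1 with h | h
        · have := Real.rpow_le_one hu.le h (by linarith : 0 ≤ γ - 1)
          have := Real.rpow_nonneg hu.le γ
          linarith
        · have := Real.rpow_le_rpow_of_exponent_le h (by linarith : γ - 1 ≤ γ)
          linarith
      have : 0 ≤ γ * Real.exp (-(γ * u)) := by positivity
      nlinarith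
  have h := hanti (show u ∈ Set.Ici 0 from hu) (show v ∈ Set.Ici 0 from hu.trans huv) huv
  simp only at h
  have e : Real.exp (γ * (v - u)) = Real.exp (-(γ * u)) * Real.exp (γ * v) := by
    rw [← Real.exp_add]; ring_nf
  have e2 : Real.exp (-(γ * v)) * Real.exp (γ * v) = 1 := by
    rw [← Real.exp_add]; simp
  calc 1 + v ^ γ = ((1 + v ^ γ) * Real.exp (-(γ * v))) * Real.exp (γ * v) := by
        rw [mul_assoc, e2, mul_one]
    _ ≤ ((1 + u ^ γ) * Real.exp (-(γ * u))) * Real.exp (γ * v) := by gcongr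
    _ = _ := by rw [e]; ring

lemma aux_lip (γ : ℝ) (hγ : 1 < γ) {y z δ : ℝ} (h : |y - z| ≤ δ) :
    1 + |y| ^ γ ≤ Real.exp (γ * δ) * (1 + |z| ^ γ) := by
  have hδ : 0 ≤ δ := (abs_nonneg _).trans h
  have h1 : |y| ≤ |z| + δ := by
    have := abs_add_le (y - z) z
    simp only [sub_add_cancel] at this
    linarith
  have h2 := aux_mono γ hγ (abs_nonneg z) (by linarith : |z| ≤ |z| + δ)
  have h3 : |y| ^ γ ≤ (|z| + δ) ^ γ := Real.rpow_le_rpow (abs_nonneg _) h1 (by linarith)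
  simp only [add_sub_cancel_left] at h2
  linarith

lemma aux_step (γ b β : ℝ) (hγ : 1 < γ) (hb : 0 < b) (hβ : 0 < β)
    {m m' c c' d t : ℝ} (hd : 0 ≤ d) (hc : 0 < c) (hc' : 0 < c')
    (h1 : c ≤ Real.exp (β * d) * c') (h2 : c' ≤ Real.exp (β * d) * c)
    (hm : |m' - m| ≤ c * Real.exp (β * d) * d) (hsmall : Real.exp (β * d) ≤ 1 + 1 / γ) :
    c' * (1 + |(t - m') * b / c'| ^ γ) ≤
      Real.exp ((γ + 1) * (b + β) * d) * (c * (1 + |(t - m) * b / c| ^ γ)) := by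
  have hγ0 : 0 < γ := by linarith
  have hz : |(t - m') * b / c - (t - m) * b / c| ≤ b * ((1 + 1 / γ) * d) := by
    have : (t - m') * b / c - (t - m) * b / c = -((m' - m) * (b / c)) := by ring
    rw [this, abs_neg, abs_mul, abs_of_pos (div_pos hb hc)]
    calc |m' - m| * (b / c) ≤ (c * Real.exp (β * d) * d) * (b / c) := by gcongr
      _ = b * (Real.exp (β * d) * d) := by field_simp
      _ ≤ _ := by gcongr
  have hl := aux_lip γ hγ hz
  have e1 : γ * (b * ((1 + 1 / γ) * d)) = (γ + 1) * b * d := by field_simp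
  rw [e1] at hl
  have hsc : c' * (1 + |(t - m') * b / c'| ^ γ) ≤
      Real.exp ((γ + 1) * β * d) * (c * (1 + |(t - m') * b / c| ^ γ)) := by
    set y := (t - m') * b / c with hy
    have hy' : (t - m') * b / c' = y * (c / c') := by rw [hy]; field_simp
    rw [hy', abs_mul, abs_of_pos (div_pos hc hc'),
      Real.mul_rpow (abs_nonneg _) (div_pos hc hc').le]
    have hy0 : 0 ≤ |y| ^ γ := by positivity
    have he1 : Real.exp (β * d) ≤ Real.exp ((γ + 1) * β * d) := by
      apply Real.exp_le_exp.2
      have : 0 ≤ γ * (β * d) := by positivity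
      nlinarith
    rcases le_total c c' with h | h
    · have hr : (c / c') ^ γ ≤ 1 :=
        Real.rpow_le_one (by positivity) ((div_le_one hc').2 h) hγ0.le
      calc c' * (1 + |y| ^ γ * (c / c') ^ γ) ≤ c' * (1 + |y| ^ γ * 1) := by gcongr
        _ ≤ (Real.exp ((γ + 1) * β * d) * c) * (1 + |y| ^ γ * 1) := by
            gcongr
            exact h2.trans (by gcongr)
        _ = _ := by ring
    · have hr1 : 1 ≤ (c / c') ^ γ :=
        Real.one_le_rpow ((one_le_div hc').2 h) hγ0.le
      have hr : (c / c') ^ γ ≤ Real.exp ((γ + 1) * β * d) := by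
        calc (c / c') ^ γ ≤ (Real.exp (β * d)) ^ γ := by
              apply Real.rpow_le_rpow (by positivity) _ hγ0.le
              rwa [div_le_iff₀ hc']
          _ = Real.exp (β * d * γ) := by rw [← Real.exp_mul]
          _ ≤ _ := by
            apply Real.exp_le_exp.2
            have : 0 ≤ (β * d) := by positivity
            nlinarith
      calc c' * (1 + |y| ^ γ * (c / c') ^ γ)
          ≤ c * ((c / c') ^ γ + |y| ^ γ * (c / c') ^ γ) := by gcongr
        _ = (c / c') ^ γ * (c * (1 + |y| ^ γ)) := by ring
        _ ≤ _ := by gcongr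
  calc _ ≤ _ := hsc
    _ ≤ Real.exp ((γ + 1) * β * d) *
        (c * (Real.exp ((γ + 1) * b * d) * (1 + |(t - m) * b / c| ^ γ))) := by gcongr
    _ = (Real.exp ((γ + 1) * β * d) * Real.exp ((γ + 1) * b * d)) *
        (c * (1 + |(t - m) * b / c| ^ γ)) := by ring
    _ = _ := by
      rw [← Real.exp_add]
      congr 2
      ring

lemma aux_chain (Q : ℝ → ℝ) (L : ℝ) (n : ℕ) (hn : 0 < n)
    (h : ∀ θ θ' : ℝ, 0 ≤ θ → θ' ≤ 1 → θ' = θ + 1 / n → Q θ' ≤ Real.exp (L * (1 / n)) * Q θ) :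
    Q 1 ≤ Real.exp L * Q 0 := by
  have hn' : (0 : ℝ) < n := by exact_mod_cast hn
  have key : ∀ i : ℕ, i ≤ n → Q (i / n) ≤ Real.exp (L * (i / n)) * Q 0 := by
    intro i
    induction i with
    | zero => intro _; simp
    | succ k ih =>
      intro hk
      have hk' : ((k + 1 : ℕ) : ℝ) ≤ n := by exact_mod_cast hk
      have := h (k / n) ((k + 1 : ℕ) / n) (by positivity) ((div_le_one hn').2 hk')
        (by push_cast; ring)
      calc _ ≤ _ := this
        _ ≤ Real.exp (L * (1 / n)) * (Real.exp (L * (k / n)) * Q 0) := by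
          gcongr
          exact ih (by omega)
        _ = _ := by
          rw [← mul_assoc, ← Real.exp_add]
          congr 2
          push_cast
          ring
  have := key n le_rfl
  rwa [div_self hn'.ne', mul_one] at this

lemma aux_affine (A B : ℝ) (hA : 0 < A) (G : ℝ → ENNReal) (hG : Measurable G) :
    ∫⁻ z, G z = ENNReal.ofReal A * ∫⁻ w, G (A * w + B) := by
  rw [← lintegral_add_right_eq_self (μ := volume) G B]
  conv_lhs => rw [← Real.smul_map_volume_mul_left hA.ne']
  rw [lintegral_smul_measure, lintegral_map (by fun_prop) (by fun_prop), abs_of_pos hA]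
  rfl


/-- Theorem (noise from smooth upper bounds on derivative sensitivity gives
ε-differential privacy, on an open convex subset of a Banach space). -/
theorem derivative_sensitivity_cauchy_noise_dp
    {E : Type*} [NormedAddCommGroup E] [NormedSpace ℝ E] [CompleteSpace E]
    (U : Set E) (hUopen : IsOpen U) (hUconv : Convex ℝ U) (hUne : U.Nonempty)
    (γ b β ε : ℝ) (hγ : 1 < γ) (hb : 0 < b) (hβ : 0 < β)
    (hε : ε = (γ + 1) * (b + β))
    (f : E → ℝ) (hf : ∀ x ∈ U, DifferentiableAt ℝ f x)
    (c : E → ℝ)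
    (hc_pos : ∀ x ∈ U, 0 < c x)
    (hc_ub : ∀ x ∈ U, ‖fderiv ℝ f x‖ ≤ c x)
    (hc_smooth : ∀ x ∈ U, ∀ x' ∈ U, c x ≤ Real.exp (β * ‖x' - x‖) * c x')
    (μ : Measure ℝ)
    (hμ : μ = volume.withDensity (fun z =>
      ENNReal.ofReal ((1 / (1 + |z| ^ γ)) / (∫ w : ℝ, 1 / (1 + |w| ^ γ)))))
    (x x' : E) (hx : x ∈ U) (hx' : x' ∈ U)
    (S : Set ℝ) (hS : MeasurableSet S) :
    μ {z | f x + (c x / b) * z ∈ S} ≤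
      ENNReal.ofReal (Real.exp (ε * ‖x' - x‖)) *
        μ {z | f x' + (c x' / b) * z ∈ S} := by
  have hγ0 : 0 < γ := by linarith
  have hcx := hc_pos x hx
  have hcx' := hc_pos x' hx'
  -- pointwise bound
  have hpt : ∀ t : ℝ, c x' * (1 + |(t - f x') * b / c x'| ^ γ) ≤
      Real.exp (ε * ‖x' - x‖) * (c x * (1 + |(t - f x) * b / c x| ^ γ)) := by
    intro t
    set D := ‖x' - x‖ with hD
    have hD0 : 0 ≤ D := norm_nonneg _
    have hlim : Filter.Tendsto (fun n : ℕ => Real.exp (β * (D * (1 / ((n : ℝ) + 1)))))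
        Filter.atTop (nhds 1) := by
      have h0 := tendsto_one_div_add_atTop_nhds_zero_nat (𝕜 := ℝ)
      have h1 := (Real.continuous_exp.tendsto _).comp ((h0.const_mul D).const_mul β)
      simpa [Function.comp_def] using h1
    have hev := hlim.eventually (ge_mem_nhds (show (1 : ℝ) < 1 + 1 / γ by
      have : 0 < 1 / γ := by positivity
      linarith))
    obtain ⟨N, hN⟩ := hev.exists
    let p : ℝ → E := fun θ => x + θ • (x' - x)
    have hp : ∀ θ, 0 ≤ θ → θ ≤ 1 → p θ ∈ U := fun θ h0 h1 =>
      hUconv.add_smul_sub_mem hx hx' ⟨h0, h1⟩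
    have hchain := aux_chain
      (fun θ => c (p θ) * (1 + |(t - f (p θ)) * b / c (p θ)| ^ γ)) (ε * D) (N + 1) (by omega) ?_
    · simpa [p] using hchain
    · intro θ θ' h0 h1 hθ
      push_cast at hθ ⊢
      set r : ℝ := 1 / ((N : ℝ) + 1) with hr
      have hr0 : 0 < r := by positivity
      have hu := hp θ h0 (by linarith)
      have hu' := hp θ' (by linarith) h1
      have hdist : ‖p θ' - p θ‖ = D * r := by
        have : p θ' - p θ = r • (x' - x) := by
          simp only [p, hθ]
          module
        rw [this, norm_smul, Real.norm_of_nonneg hr0.le, mul_comm]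
      have hdist' : ‖p θ - p θ'‖ = D * r := by rw [norm_sub_rev, hdist]
      have hs1 := hc_smooth _ hu _ hu'
      have hs2 := hc_smooth _ hu' _ hu
      rw [hdist] at hs1
      rw [hdist'] at hs2
      have hm : |f (p θ') - f (p θ)| ≤ c (p θ) * Real.exp (β * (D * r)) * (D * r) := by
        have hseg : segment ℝ (p θ) (p θ') ⊆ U := hUconv.segment_subset hu hu'
        have := (convex_segment (p θ) (p θ')).norm_image_sub_le_of_norm_fderiv_le
          (𝕜 := ℝ) (f := f) (C := c (p θ) * Real.exp (β * (D * r)))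
          (fun y hy => hf y (hseg hy)) (fun y hy => ?_)
          (left_mem_segment ℝ _ _) (right_mem_segment ℝ _ _)
        · rwa [hdist, Real.norm_eq_abs] at this
        · have h3 := hc_ub y (hseg hy)
          have h4 := hc_smooth y (hseg hy) _ hu
          have h5 : ‖p θ - y‖ ≤ D * r := by
            rw [← hdist', norm_sub_rev, norm_sub_rev (p θ)]
            obtain ⟨a, a', ha, ha', haa, rfl⟩ := hy
            have : a • p θ + a' • p θ' - p θ = a' • (p θ' - p θ) := by
              have : a = 1 - a' := by linarith
              rw [this]; module
            rw [this, norm_smul, Real.norm_of_nonneg ha']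
            have := norm_nonneg (p θ' - p θ)
            nlinarith
          calc _ ≤ _ := h3
            _ ≤ _ := h4
            _ ≤ Real.exp (β * (D * r)) * c (p θ) := by
              have := hc_pos _ hu
              gcongr
            _ = _ := mul_comm _ _
      have := aux_step γ b β hγ hb hβ (t := t) (by positivity) (hc_pos _ hu) (hc_pos _ hu')
        hs1 hs2 hm hN
      rw [hε]
      convert this using 3
      ring
  -- measure part
  set C := ∫ w : ℝ, 1 / (1 + |w| ^ γ) with hC
  have hC0 : 0 ≤ C := integral_nonneg fun w => by positivity
  set h : ℝ → ENNReal := fun z => ENNReal.ofReal ((1 / (1 + |z| ^ γ)) / C) with hh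
  have hmeas : Measurable h := by
    have : Measurable (fun z : ℝ => |z| ^ γ) := by fun_prop
    fun_prop
  have hSm : ∀ m s : ℝ, MeasurableSet {z : ℝ | m + s * z ∈ S} := fun m s =>
    (show Measurable (fun z : ℝ => m + s * z) by fun_prop) hS
  rw [hμ, withDensity_apply _ (hSm _ _), withDensity_apply _ (hSm _ _),
    ← lintegral_indicator (hSm _ _), ← lintegral_indicator (hSm _ _),
    aux_affine (c x' / c x) ((f x' - f x) * b / c x) (by positivity) _
      (hmeas.indicator (hSm _ _)),
    ← lintegral_const_mul' _ _ ENNReal.ofReal_ne_top,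
    ← lintegral_const_mul' _ _ ENNReal.ofReal_ne_top]
  apply lintegral_mono
  intro w
  have heq : f x + c x / b * (c x' / c x * w + (f x' - f x) * b / c x) =
      f x' + c x' / b * w := by
    field_simp
    ring
  beta_reduce
  by_cases hw : f x' + c x' / b * w ∈ S
  · have hw1 : c x' / c x * w + (f x' - f x) * b / c x ∈ {z : ℝ | f x + c x / b * z ∈ S} := by
      change f x + c x / b * (c x' / c x * w + (f x' - f x) * b / c x) ∈ S
      rwa [heq]
    have hw2 : w ∈ {z : ℝ | f x' + c x' / b * z ∈ S} := hw
    rw [Set.indicator_of_mem hw1, Set.indicator_of_mem hw2]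
    simp only [hh]
    rw [← ENNReal.ofReal_mul (by positivity), ← ENNReal.ofReal_mul (by positivity)]
    apply ENNReal.ofReal_le_ofReal
    have hp := hpt (f x' + c x' / b * w)
    have e1 : (f x' + c x' / b * w - f x') * b / c x' = w := by field_simp; ring
    have e2 : (f x' + c x' / b * w - f x) * b / c x =
        c x' / c x * w + (f x' - f x) * b / c x := by field_simp; ring
    rw [e1, e2] at hp
    set z := c x' / c x * w + (f x' - f x) * b / c x
    rw [← mul_div_assoc _ _ C, ← mul_div_assoc _ _ C]
    apply div_le_div_of_nonneg_right _ hC0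
    rw [mul_one_div, mul_one_div, div_div, div_le_div_iff₀ (by positivity) (by positivity)]
    exact hp
  · have hw1 : c x' / c x * w + (f x' - f x) * b / c x ∉ {z : ℝ | f x + c x / b * z ∈ S} := by
      change ¬ (f x + c x / b * (c x' / c x * w + (f x' - f x) * b / c x) ∈ S)
      rwa [heq]
    rw [Set.indicator_of_notMem hw1, mul_zero]
    exact zero_le
end

section
/- Let X be a real Banach space and β > 0. Let f : X → ℝ be Fréchet differentiable at every point, with f(x) > 0 for all x ∈ X, and suppose that the derivative sensitivity satisfies ‖df_x‖ ≤ β·f(x) for all x ∈ X. Then f is β-smooth: f(x) ≤ exp(β·‖x′ − x‖)·f(x′) for all x, x′ ∈ X. -/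
open Real

/-- If a positive differentiable function on a Banach space satisfies
`‖df_x‖ ≤ β·f(x)` everywhere, then it is β-smooth. -/
theorem beta_smooth_of_dersens_le
    {X : Type*} [NormedAddCommGroup X] [NormedSpace ℝ X] [CompleteSpace X]
    (β : ℝ) (hβ : 0 < β)
    (f : X → ℝ) (hf : Differentiable ℝ f)
    (hfpos : ∀ x, 0 < f x)
    (hds : ∀ x, ‖fderiv ℝ f x‖ ≤ β * f x) :
    ∀ x x' : X, f x ≤ Real.exp (β * ‖x' - x‖) * f x' := by
  intro x x'
  have hd : ∀ y ∈ (Set.univ : Set X), HasFDerivWithinAt (fun z => Real.log (f z))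
      ((f y)⁻¹ • fderiv ℝ f y) Set.univ y := fun y _ =>
    ((hf y).hasFDerivAt.log (hfpos y).ne').hasFDerivWithinAt
  have hb : ∀ y ∈ (Set.univ : Set X), ‖(f y)⁻¹ • fderiv ℝ f y‖ ≤ β := by
    intro y _
    rw [norm_smul, norm_inv, Real.norm_of_nonneg (hfpos y).le, inv_mul_le_iff₀ (hfpos y)]
    linarith [hds y]
  have h := convex_univ.norm_image_sub_le_of_norm_hasFDerivWithin_le hd hb
    (Set.mem_univ x) (Set.mem_univ x')
  rw [Real.norm_eq_abs] at h
  have h2 := (abs_le.mp h).1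
  rw [← Real.log_le_log_iff (hfpos x) (mul_pos (Real.exp_pos _) (hfpos x')),
    Real.log_mul (Real.exp_pos _).ne' (hfpos x').ne', Real.log_exp]
  linarith
end

section
/- Let p be a real number with 1 < p < ∞ and let q = p/(p−1). Let X₁, …, X_n be real Banach spaces and let X = X₁ × ⋯ × X_n be equipped with the ℓ_q-combination norm ‖x‖ = (∑_{i=1}^{n} ‖x_i‖_{X_i}^q)^{1/q}. For each i, let f_i : X_i → ℝ satisfy f_i > 0 everywhere and be β_i-smooth, i.e., f_i(x_i) ≤ exp(β_i·‖x_i − x_i′‖)·f_i(x_i′) for all x_i, x_i′ ∈ X_i, where β_i ≥ 0. Define F(x₁,…,x_n) = (∑_{i=1}^{n} f_i(x_i)^p)^{1/p}. Then F is (max_{i} β_i)-smooth with respect to the norm on X, i.e., F(x) ≤ exp((max_i β_i)·‖x − x′‖)·F(x′) for all x, x′ ∈ X; in particular F is also (∑_i β_i^p)^{1/p}-smooth with respect to this norm. -/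
open Real Finset

/-- If each `fᵢ : Xᵢ → ℝ` is positive and `βᵢ`-smooth, then
`F(x) = ‖(f₁(x₁),…,f_n(x_n))‖_p` is `max βᵢ`-smooth (hence also
`‖β‖_p`-smooth) on the ℓ_q-combination of the `Xᵢ`, `q = p/(p-1)`. -/
theorem lp_comb_smooth
    (p : ℝ) (hp : 1 < p) (q : ℝ) (hq : q = p / (p - 1))
    [Fact (1 ≤ ENNReal.ofReal q)]
    (n : ℕ) (hn : 0 < n)
    {X : Fin n → Type*} [∀ i, NormedAddCommGroup (X i)] [∀ i, NormedSpace ℝ (X i)]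
    [∀ i, CompleteSpace (X i)]
    (β : Fin n → ℝ) (hβ : ∀ i, 0 ≤ β i)
    (f : ∀ i, X i → ℝ) (hfpos : ∀ i x, 0 < f i x)
    (hsmooth : ∀ i, ∀ x x' : X i, f i x ≤ Real.exp (β i * ‖x - x'‖) * f i x')
    (F : PiLp (ENNReal.ofReal q) X → ℝ)
    (hF : F = fun x => (∑ i, f i (WithLp.equiv (ENNReal.ofReal q) (∀ i, X i) x i) ^ p) ^ (1 / p)) :
    (∀ x x' : PiLp (ENNReal.ofReal q) X,
      F x ≤ Real.exp
        ((Finset.univ.sup'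
            (Finset.univ_nonempty_iff.mpr (Fin.pos_iff_nonempty.mp hn)) β)
          * ‖x - x'‖) * F x') ∧
    (∀ x x' : PiLp (ENNReal.ofReal q) X,
      F x ≤ Real.exp (((∑ i, β i ^ p) ^ (1 / p)) * ‖x - x'‖) * F x') := by
  have key : ∀ B : ℝ, (∀ i, β i ≤ B) → ∀ x x' : PiLp (ENNReal.ofReal q) X,
      F x ≤ Real.exp (B * ‖x - x'‖) * F x' := by
    intro B hB x x'
    have hp0 : 0 < p := by linarith
    have hpt : ∀ i, f i (x i) ≤ Real.exp (B * ‖x - x'‖) * f i (x' i) := by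
      intro i
      refine (hsmooth i (x i) (x' i)).trans ?_
      refine mul_le_mul_of_nonneg_right (Real.exp_le_exp.mpr ?_) (hfpos i _).le
      have h1 : ‖x i - x' i‖ ≤ ‖x - x'‖ := PiLp.norm_apply_le (x - x') i
      exact mul_le_mul (hB i) h1 (norm_nonneg _) ((hβ i).trans (hB i))
    rw [hF]
    change (∑ i, f i (x i) ^ p) ^ (1 / p) ≤ Real.exp (B * ‖x - x'‖) * (∑ i, f i (x' i) ^ p) ^ (1 / p)
    generalize Real.exp (B * ‖x - x'‖) = E at hpt ⊢
    have hE : 0 ≤ E := by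
      have h := (hfpos ⟨0, hn⟩ (x ⟨0, hn⟩)).trans_le (hpt ⟨0, hn⟩)
      exact (pos_of_mul_pos_left h (hfpos ⟨0, hn⟩ _).le).le
    have hS : ∀ y : PiLp (ENNReal.ofReal q) X, 0 ≤ ∑ i, f i (y i) ^ p := fun y =>
      Finset.sum_nonneg fun i _ => Real.rpow_nonneg (hfpos i _).le _
    calc (∑ i, f i (x i) ^ p) ^ (1 / p) ≤ (E ^ p * ∑ i, f i (x' i) ^ p) ^ (1 / p) := by
          refine Real.rpow_le_rpow (hS x) ?_ (by positivity)
          rw [Finset.mul_sum]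
          refine Finset.sum_le_sum fun i _ => ?_
          rw [← Real.mul_rpow hE (hfpos i _).le]
          exact Real.rpow_le_rpow (hfpos i _).le (hpt i) hp0.le
      _ = E * (∑ i, f i (x' i) ^ p) ^ (1 / p) := by
          rw [Real.mul_rpow (Real.rpow_nonneg hE _) (hS x'), ← Real.rpow_mul hE,
            mul_one_div_cancel hp0.ne', Real.rpow_one]
  refine ⟨key _ fun i => Finset.le_sup' β (Finset.mem_univ i), key _ fun i => ?_⟩
  have hp0 : 0 < p := by linarith
  calc β i = (β i ^ p) ^ (1 / p) := by
        rw [← Real.rpow_mul (hβ i), mul_one_div_cancel hp0.ne', Real.rpow_one]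
    _ ≤ _ := Real.rpow_le_rpow (Real.rpow_nonneg (hβ i) _)
        (Finset.single_le_sum (f := fun j => β j ^ p)
          (fun j _ => Real.rpow_nonneg (hβ j) _) (Finset.mem_univ i)) (by positivity)
end

section
/- Let r > 0 and β > 0 be real numbers, and consider f(x) = x^r on the positive reals. Define ĝ : (0,∞) → ℝ by ĝ(x) = x^r if x ≥ r/β, and ĝ(x) = exp(βx − r)·(r/β)^r otherwise. Then ĝ is a β-smooth upper bound on f on (0,∞): (i) x^r ≤ ĝ(x) for all x > 0, and (ii) ĝ(x) ≤ exp(β·|x − x′|)·ĝ(x′) for all x, x′ > 0. -/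
open Real

/-- The piecewise function `ĝ` is a β-smooth upper bound on `x ↦ x^r`
on the positive reals. -/
theorem power_smooth_upper_bound
    (r β : ℝ) (hr : 0 < r) (hβ : 0 < β)
    (g : ℝ → ℝ)
    (hg : ∀ x : ℝ, g x =
      if r / β ≤ x then x ^ r else Real.exp (β * x - r) * (r / β) ^ r) :
    (∀ x : ℝ, 0 < x → x ^ r ≤ g x) ∧
    (∀ x : ℝ, 0 < x → ∀ x' : ℝ, 0 < x' →
      g x ≤ Real.exp (β * |x - x'|) * g x') := by
  have hc : 0 < r / β := div_pos hr hβ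
  have hbc : β * (r / β) = r := by field_simp
  generalize r / β = c at *
  -- tangent-line bound
  have key : ∀ x y : ℝ, c ≤ y → y ≤ x → Real.log x * r ≤ Real.log y * r + β * (x - y) := by
    intro x y hy hxy
    have hy0 : 0 < y := by linarith
    have hx0 : 0 < x := by linarith
    have h1 := Real.log_le_sub_one_of_pos (div_pos hx0 hy0)
    rw [Real.log_div hx0.ne' hy0.ne'] at h1
    have h2 : (x / y - 1) * r ≤ β * (x - y) := by
      have : x / y - 1 = (x - y) / y := by field_simp
      rw [this, div_mul_eq_mul_div, div_le_iff₀ hy0]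
      have h3 : r ≤ β * y := by rw [← hbc]; gcongr
      nlinarith [mul_le_mul_of_nonneg_left h3 (sub_nonneg.2 hxy)]
    nlinarith [mul_le_mul_of_nonneg_right h1 hr.le]
  have keyc : ∀ x : ℝ, 0 < x → Real.log x * r ≤ β * x - r + Real.log c * r := by
    intro x hx0
    have h1 := Real.log_le_sub_one_of_pos (div_pos hx0 hc)
    rw [Real.log_div hx0.ne' hc.ne'] at h1
    have h2 : (x / c - 1) * r = β * x - r := by
      rw [← hbc]; field_simp
    nlinarith [mul_le_mul_of_nonneg_right h1 hr.le]
  refine ⟨fun x hx => ?_, fun x hx x' hx' => ?_⟩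
  · rw [hg]
    split_ifs with h
    · exact le_rfl
    · rw [Real.rpow_def_of_pos hx, Real.rpow_def_of_pos hc, ← Real.exp_add]
      exact Real.exp_le_exp.2 (keyc x hx)
  · have ha := mul_le_mul_of_nonneg_left (le_abs_self (x - x')) hβ.le
    have ha0 := mul_nonneg hβ.le (abs_nonneg (x - x'))
    rw [hg, hg, Real.rpow_def_of_pos hx, Real.rpow_def_of_pos hx', Real.rpow_def_of_pos hc]
    split_ifs with h h' h' <;> simp only [← Real.exp_add] <;> apply Real.exp_le_exp.2
    · rcases le_total x' x with hh | hh
      · linarith [key x x' h' hh]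
      · have := mul_le_mul_of_nonneg_right (Real.log_le_log hx hh) hr.le
        linarith
    · linarith [keyc x hx]
    · have := mul_le_mul_of_nonneg_right (Real.log_le_log hc h') hr.le
      have := mul_le_mul_of_nonneg_left (not_le.1 h).le hβ.le
      linarith
    · linarith
end

section
/- Let r > 1 and β > 0 be real numbers. The derivative of f(x) = x^r on (0,∞) is f′(x) = r·x^{r−1}. Define ĥ : (0,∞) → ℝ by ĥ(x) = r·x^{r−1} if x ≥ (r−1)/β, and ĥ(x) = r·exp(βx − (r−1))·((r−1)/β)^{r−1} otherwise. Then ĥ is a β-smooth upper bound on the derivative sensitivity x ↦ r·x^{r−1}: (i) r·x^{r−1} ≤ ĥ(x) for all x > 0, and (ii) ĥ(x) ≤ exp(β·|x − x′|)·ĥ(x′) for all x, x′ > 0. -/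
open Real

/-- `x ↦ x^r` on `(0,∞)` has derivative `r·x^{r-1}`, and the piecewise
function `ĥ` is a β-smooth upper bound on this derivative sensitivity. -/
theorem power_deriv_smooth_upper_bound
    (r β : ℝ) (hr : 1 < r) (hβ : 0 < β)
    (h : ℝ → ℝ)
    (hh : ∀ x : ℝ, h x =
      if (r - 1) / β ≤ x then r * x ^ (r - 1)
      else r * Real.exp (β * x - (r - 1)) * ((r - 1) / β) ^ (r - 1)) :
    (∀ x : ℝ, 0 < x → HasDerivAt (fun t : ℝ => t ^ r) (r * x ^ (r - 1)) x) ∧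
    (∀ x : ℝ, 0 < x → r * x ^ (r - 1) ≤ h x) ∧
    (∀ x : ℝ, 0 < x → ∀ x' : ℝ, 0 < x' →
      h x ≤ Real.exp (β * |x - x'|) * h x') := by
  have ha : 0 < r - 1 := by linarith
  set a := r - 1 with ha'
  obtain ⟨c, hc⟩ : ∃ c, c = a / β := ⟨_, rfl⟩
  have hc0 : 0 < c := by rw [hc]; positivity
  have hcb : β * c = a := by rw [hc]; field_simp
  rw [← hc] at hh
  have hr0 : 0 < r := by linarith
  have L : ∀ x y : ℝ, 0 < x → c ≤ y → log x * a - log y * a ≤ β * |x - y| := by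
    intro x y hx hy
    have hy0 : 0 < y := by linarith
    rcases le_total x y with hxy | hxy
    · have h1 := mul_le_mul_of_nonneg_right (Real.log_le_log hx hxy) ha.le
      have : 0 ≤ β * |x - y| := by positivity
      linarith
    · rw [abs_of_nonneg (by linarith)]
      have h1 := Real.log_le_sub_one_of_pos (div_pos hx hy0)
      rw [Real.log_div hx.ne' hy0.ne'] at h1
      have h2 : x / y - 1 = (x - y) / y := by field_simp
      rw [h2] at h1
      have h3 : (x - y) / y * a ≤ β * (x - y) := by
        rw [div_mul_eq_mul_div, div_le_iff₀ hy0]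
        nlinarith [mul_le_mul_of_nonneg_left hy (mul_nonneg hβ.le (sub_nonneg.2 hxy))]
      nlinarith [mul_le_mul_of_nonneg_right h1 ha.le]
  have L2 : ∀ x : ℝ, 0 < x → log x * a ≤ log c * a + (β * x - a) := by
    intro x hx
    have h1 := Real.log_le_sub_one_of_pos (div_pos hx hc0)
    rw [Real.log_div hx.ne' hc0.ne'] at h1
    have h3 : (x / c - 1) * a = β * x - a := by
      rw [← hcb]; field_simp
    nlinarith [mul_le_mul_of_nonneg_right h1 ha.le]
  have H1 : ∀ x, 0 < x → c ≤ x → h x = r * exp (log x * a) := by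
    intro x hx hcx
    rw [hh, if_pos hcx, Real.rpow_def_of_pos hx]
  have H2 : ∀ x, ¬ c ≤ x → h x = r * exp (log c * a + (β * x - a)) := by
    intro x hcx
    rw [hh, if_neg hcx, Real.rpow_def_of_pos hc0, Real.exp_add]
    ring
  have K : ∀ u v w : ℝ, u ≤ w + v → r * exp u ≤ exp w * (r * exp v) := by
    intro u v w huv
    have := mul_le_mul_of_nonneg_left (Real.exp_le_exp.2 huv) hr0.le
    rw [Real.exp_add] at this
    linarith
  refine ⟨?_, ?_, ?_⟩
  · intro x hx
    exact Real.hasDerivAt_rpow_const (Or.inl hx.ne')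
  · intro x hx
    rw [Real.rpow_def_of_pos hx]
    by_cases hcx : c ≤ x
    · rw [H1 x hx hcx]
    · rw [H2 x hcx]
      exact mul_le_mul_of_nonneg_left (Real.exp_le_exp.2 (L2 x hx)) hr0.le
  · intro x hx y hy
    have habs := mul_le_mul_of_nonneg_left (le_abs_self (x - y)) hβ.le
    by_cases hcx : c ≤ x <;> by_cases hcy : c ≤ y
    · rw [H1 x hx hcx, H1 y hy hcy]
      apply K
      linarith [L x y hx hcy]
    · rw [H1 x hx hcx, H2 y hcy]
      apply K
      linarith [L2 x hx]
    · rw [H2 x hcx, H1 y hy hcy]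
      apply K
      have h1 := mul_le_mul_of_nonneg_right (Real.log_le_log hc0 hcy) ha.le
      have h2 := mul_le_mul_of_nonneg_left (not_le.1 hcx).le hβ.le
      have : 0 ≤ β * |x - y| := by positivity
      linarith
    · rw [H2 x hcx, H2 y hcy]
      apply K
      linarith
end

section
/- Let β > 0 be a real number. Define ĝ : ℝ → ℝ by ĝ(x) = |x| if |x| ≥ 1/β, and ĝ(x) = exp(β·|x| − 1)/β otherwise. Then ĝ is a β-smooth upper bound on the absolute value function: (i) |x| ≤ ĝ(x) for all x ∈ ℝ, and (ii) ĝ(x) ≤ exp(β·|x − x′|)·ĝ(x′) for all x, x′ ∈ ℝ. -/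
open Real

/-- The piecewise function `ĝ` is a β-smooth upper bound on the absolute
value function on ℝ. -/
theorem abs_smooth_upper_bound
    (β : ℝ) (hβ : 0 < β)
    (g : ℝ → ℝ)
    (hg : ∀ x : ℝ, g x =
      if 1 / β ≤ |x| then |x| else Real.exp (β * |x| - 1) / β) :
    (∀ x : ℝ, |x| ≤ g x) ∧
    (∀ x x' : ℝ, g x ≤ Real.exp (β * |x - x'|) * g x') := by
  have key : ∀ x : ℝ, β * g x = if 1 ≤ β * |x| then β * |x| else Real.exp (β * |x| - 1) := by
    intro x
    have hiff : 1 / β ≤ |x| ↔ 1 ≤ β * |x| := by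
      rw [div_le_iff₀ hβ, mul_comm]
    rw [hg x]
    by_cases h : 1 ≤ β * |x|
    · rw [if_pos (hiff.2 h), if_pos h]
    · rw [if_neg (fun h' => h (hiff.1 h')), if_neg h]
      field_simp
  constructor
  · intro x
    refine le_of_mul_le_mul_left ?_ hβ
    rw [key x]
    split_ifs with h
    · exact le_rfl
    · linarith [Real.add_one_le_exp (β * |x| - 1)]
  · intro x x'
    refine le_of_mul_le_mul_left ?_ hβ
    rw [mul_left_comm, key x, key x']
    have hd : β * |x| ≤ β * |x'| + β * |x - x'| := by
      rw [← mul_add]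
      refine mul_le_mul_of_nonneg_left ?_ hβ.le
      linarith [abs_sub_abs_le_abs_sub x x']
    have hd0 : 0 ≤ β * |x - x'| := by positivity
    generalize β * |x - x'| = d at *
    generalize β * |x| = u at *
    generalize β * |x'| = v at *
    have h1 := Real.add_one_le_exp d
    split_ifs with hu hv hv
    · nlinarith
    · rw [← Real.exp_add]
      have h2 := Real.add_one_le_exp (u - 1)
      have h3 : Real.exp (u - 1) ≤ Real.exp (d + (v - 1)) := Real.exp_le_exp.2 (by linarith)
      linarith
    · have h2 : Real.exp (u - 1) ≤ 1 := Real.exp_le_one_iff.2 (by linarith)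
      nlinarith
    · rw [← Real.exp_add]
      exact Real.exp_le_exp.2 (by linarith)
end

section
/- Let α > 0 and define the sigmoid function σ : ℝ → ℝ by σ(x) = e^{αx}/(e^{αx} + 1). Then: (i) the derivative of σ is σ′(x) = α·e^{αx}/(e^{αx} + 1)²; (ii) σ is α-smooth, i.e., σ(x) ≤ exp(α·|x − y|)·σ(y) for all x, y ∈ ℝ; and (iii) the derivative sensitivity |σ′| is α-smooth, i.e., σ′(x) ≤ exp(α·|x − y|)·σ′(y) for all x, y ∈ ℝ. -/
open Real

/-- The sigmoid `σ(x) = e^{αx}/(e^{αx}+1)` has derivative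
`α·e^{αx}/(e^{αx}+1)²`, and both `σ` and its derivative sensitivity are
α-smooth. -/
theorem sigmoid_smooth
    (α : ℝ) (hα : 0 < α)
    (σ : ℝ → ℝ) (hσ : σ = fun x => Real.exp (α * x) / (Real.exp (α * x) + 1)) :
    (∀ x : ℝ, HasDerivAt σ
      (α * Real.exp (α * x) / (Real.exp (α * x) + 1) ^ 2) x) ∧
    (∀ x y : ℝ, σ x ≤ Real.exp (α * |x - y|) * σ y) ∧
    (∀ x y : ℝ, α * Real.exp (α * x) / (Real.exp (α * x) + 1) ^ 2 ≤
      Real.exp (α * |x - y|) *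
        (α * Real.exp (α * y) / (Real.exp (α * y) + 1) ^ 2)) := by
  have key : ∀ x y : ℝ, Real.exp (α * x) ≤ Real.exp (α * |x - y|) * Real.exp (α * y) := by
    intro x y
    rw [← Real.exp_add]
    apply Real.exp_le_exp.mpr
    nlinarith [le_abs_self (x - y)]
  have one : ∀ x y : ℝ, 1 ≤ Real.exp (α * |x - y|) := fun x y =>
    Real.one_le_exp (by positivity)
  refine ⟨fun x => ?_, fun x y => ?_, fun x y => ?_⟩
  · subst hσ
    have h1 : HasDerivAt (fun x : ℝ => Real.exp (α * x)) (Real.exp (α * x) * (α * 1)) x :=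
      ((hasDerivAt_id x).const_mul α).exp
    have h2 := h1.div (h1.add_const 1) (by positivity)
    refine HasDerivAt.congr_deriv h2 ?_
    congr 1
    ring
  · subst hσ
    have h1 := key x y
    have h3 := one x y
    have ha := Real.exp_pos (α * x)
    have hb := Real.exp_pos (α * y)
    show Real.exp (α * x) / (Real.exp (α * x) + 1) ≤ Real.exp (α * |x - y|) * (Real.exp (α * y) / (Real.exp (α * y) + 1))
    generalize Real.exp (α * x) = a at *
    generalize Real.exp (α * y) = b at *
    generalize Real.exp (α * |x - y|) = E at *
    rw [← mul_div_assoc, div_le_div_iff₀ (by positivity) (by positivity)]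
    nlinarith [mul_le_mul_of_nonneg_right h3 (mul_pos ha hb).le]
  · have h1 := key x y
    have h2 := key y x
    rw [abs_sub_comm y x] at h2
    have h3 := one x y
    have ha := Real.exp_pos (α * x)
    have hb := Real.exp_pos (α * y)
    generalize Real.exp (α * x) = a at *
    generalize Real.exp (α * y) = b at *
    generalize Real.exp (α * |x - y|) = E at *
    have h4 : a * (b + 1) ^ 2 ≤ E * b * (a + 1) ^ 2 := by
      nlinarith [mul_le_mul_of_nonneg_right h3 (mul_pos ha hb).le,
        mul_le_mul_of_nonneg_right h2 (mul_pos ha hb).le]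
    rw [← mul_div_assoc, div_le_div_iff₀ (by positivity) (by positivity)]
    nlinarith [mul_le_mul_of_nonneg_left h4 hα.le]
end

section
/- Let α > 0 and define the tauoid function τ : ℝ → ℝ by τ(x) = 2/(e^{−αx} + e^{αx}). Then: (i) τ is α-smooth, i.e., τ(x) ≤ exp(α·|x − y|)·τ(y) for all x, y ∈ ℝ; (ii) the derivative of τ satisfies |τ′(x)| ≤ α·τ(x) for all x ∈ ℝ, so that x ↦ α·τ(x) is an upper bound on the derivative sensitivity of τ; and (iii) the function x ↦ α·τ(x) is itself α-smooth. -/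
open Real

/-- The tauoid `τ(x) = 2/(e^{-αx}+e^{αx})` is α-smooth, `α·τ` is an upper
bound on its derivative sensitivity, and `α·τ` is itself α-smooth. -/
theorem tauoid_smooth
    (α : ℝ) (hα : 0 < α)
    (τ : ℝ → ℝ)
    (hτ : τ = fun x => 2 / (Real.exp (-(α * x)) + Real.exp (α * x))) :
    (∀ x y : ℝ, τ x ≤ Real.exp (α * |x - y|) * τ y) ∧
    (∀ x : ℝ, |deriv τ x| ≤ α * τ x) ∧
    (∀ x y : ℝ, α * τ x ≤ Real.exp (α * |x - y|) * (α * τ y)) := by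
  have key : ∀ x y : ℝ, τ x ≤ Real.exp (α * |x - y|) * τ y := by
    intro x y
    have h1 : Real.exp (-(α * y)) ≤ Real.exp (α * |x - y|) * Real.exp (-(α * x)) := by
      rw [← Real.exp_add]
      apply Real.exp_le_exp.mpr
      nlinarith [le_abs_self (x - y)]
    have h2 : Real.exp (α * y) ≤ Real.exp (α * |x - y|) * Real.exp (α * x) := by
      rw [← Real.exp_add]
      apply Real.exp_le_exp.mpr
      nlinarith [neg_abs_le (x - y)]
    subst hτ
    simp only
    rw [← mul_div_assoc, div_le_div_iff₀ (by positivity) (by positivity)]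
    linarith
  refine ⟨key, ?_, ?_⟩
  · intro x
    have ha : HasDerivAt (fun x : ℝ => α * x) α x := by
      simpa using (hasDerivAt_id x).const_mul α
    have hd := (hasDerivAt_const x (2 : ℝ)).fun_div (ha.fun_neg.exp.fun_add ha.exp)
      (by positivity)
    subst hτ
    rw [hd.deriv]
    simp only
    have p := Real.exp_pos (-(α * x))
    have q := Real.exp_pos (α * x)
    generalize Real.exp (-(α * x)) = a at *
    generalize Real.exp (α * x) = b at *
    have e : α * (2 / (a + b)) = (α * 2 * (a + b)) / (a + b) ^ 2 := by
      field_simp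
    rw [e, abs_div, abs_of_pos (by positivity : 0 < (a + b) ^ 2)]
    apply div_le_div_of_nonneg_right _ (by positivity)
    have := mul_pos hα p
    have := mul_pos hα q
    rw [abs_le]
    constructor <;> nlinarith
  · intro x y
    have := mul_le_mul_of_nonneg_left (key x y) hα.le
    linarith
end
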